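/- arXiv:2204.13297 — 2 statements merged into one kernel-verified Lean document; each statement's English description precedes it below -/
import Mathlib

section
/- MLR is truth-table Medvedev reducible to Either(MLR): there exists a truth-table reduction Φ such that for every X ∈ Either(MLR), the output Φ^X is Martin-Löf random. In symbols, MLR ≤_{s,tt} Either(MLR). -/
open MeasureTheory

/-- Cantor space `2^ω`: functions from `ℕ` to `Bool`. -/
abbrev Cantor : Type := ℕ → Bool

/-- The fair-coin product measure on Cantor space (each bit is `true` with probability 1/2,
independently), realized concretely as the pushforward of Lebesgue measure on `[0,1)`
under the binary-digit map `x ↦ (n ↦ n-th binary digit of x)`. -/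
noncomputable def fairCoin : Measure Cantor :=
  Measure.map (fun (x : ℝ) (n : ℕ) => decide ((⌊x * 2 ^ (n + 1)⌋ % 2 : ℤ) = 1))
    (volume.restrict (Set.Ico (0 : ℝ) 1))

/-- The cylinder `[σ]` of all `X ∈ 2^ω` extending the finite binary string `σ`. -/
def cylinder (σ : List Bool) : Set Cantor :=
  {X | ∀ (i : ℕ) (h : i < σ.length), X i = σ.get ⟨i, h⟩}

/-- The `n`-th level `U_n` of a test `U`: the union of the cylinders enumerated by `U n`. -/
def testSet (U : ℕ → ℕ → Option (List Bool)) (n : ℕ) : Set Cantor :=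
  ⋃ σ ∈ {σ : List Bool | ∃ k, U n k = some σ}, cylinder σ

/-- A Martin-Löf test: a computable enumeration of cylinders with `μ(U_n) ≤ 2^{-n}`. -/
def MLTest (U : ℕ → ℕ → Option (List Bool)) : Prop :=
  Computable₂ U ∧ ∀ n, fairCoin (testSet U n) ≤ ((2 : ENNReal) ^ n)⁻¹

/-- The Martin-Löf random elements of Cantor space. -/
def MLR : Set Cantor :=
  {X | ∀ U : ℕ → ℕ → Option (List Bool), MLTest U → ∃ n, X ∉ testSet U n}

/-- The computability-theoretic join: `(A ⊕ B)(2k) = A(k)` and `(A ⊕ B)(2k+1) = B(k)`. -/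
def join (A B : Cantor) : Cantor := fun n => if n % 2 = 0 then A (n / 2) else B (n / 2)

/-- `Either(C) = {A ⊕ B : A ∈ C or B ∈ C}`. -/
def Either (C : Set Cantor) : Set Cantor :=
  {Z | ∃ A B : Cantor, Z = join A B ∧ (A ∈ C ∨ B ∈ C)}

/-- The natural number with the given (little-endian) list of bits. -/
def bitsToNat : List Bool → ℕ
  | [] => 0
  | b :: l => (cond b 1 0) + 2 * bitsToNat l

/-- A truth-table reduction, given by query positions `q n` and a truth table `t n`
with one entry for each of the `2^{|q n|}` possible bit-vectors of answers;
the pair must be computable (as a function of `n`), uniformly. -/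
def TTReduction (q : ℕ → List ℕ) (t : ℕ → List Bool) : Prop :=
  Computable (fun n => (q n, t n)) ∧ ∀ n, (t n).length = 2 ^ (q n).length

/-- The output `Φ^X` of the truth-table reduction given by `(q, t)` on oracle `X`:
bit `n` is the entry of `t n` indexed by the bit-vector of oracle answers. -/
def ttEval (q : ℕ → List ℕ) (t : ℕ → List Bool) (X : Cantor) : Cantor :=
  fun n => (t n).getD (bitsToNat ((q n).map X)) false


def pre (X : Cantor) (n : ℕ) : List Bool := (List.range n).map X

theorem length_pre (X : Cantor) (n : ℕ) : (pre X n).length = n := by simp [pre]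

theorem take_pre (X : Cantor) {m n : ℕ} (h : m ≤ n) : (pre X n).take m = pre X m := by
  simp [pre, ← List.map_take, List.take_range, h]

theorem mem_cylinder_iff (σ : List Bool) (X : Cantor) : X ∈ cylinder σ ↔ pre X σ.length = σ := by
  constructor
  · intro h
    apply List.ext_getElem
    · simp [pre]
    · intro i h1 h2
      have := h i h2
      simpa [pre] using this
  · intro h i hi
    have : (pre X σ.length)[i]'(by simpa [pre] using hi) = σ[i] := by simp only [h]
    simpa [pre] using this

theorem mem_cylinder_iff_take (σ : List Bool) (X : Cantor) {s : ℕ} (hs : σ.length ≤ s) :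
    X ∈ cylinder σ ↔ (pre X s).take σ.length = σ := by
  rw [mem_cylinder_iff, take_pre X hs]

theorem measurableSet_cylinder (σ : List Bool) : MeasurableSet (cylinder σ) := by
  have : cylinder σ = ⋂ (i : ℕ) (h : i < σ.length), (fun X : Cantor => X i) ⁻¹' {σ.get ⟨i, h⟩} := by
    ext X; simp [_root_.cylinder]
  rw [this]
  exact MeasurableSet.iInter fun i => MeasurableSet.iInter fun h =>
    (measurable_pi_apply i) (measurableSet_singleton _)

theorem measurableSet_testSet (U) (n : ℕ) : MeasurableSet (testSet U n) :=
  MeasurableSet.biUnion (Set.to_countable _) fun σ _ => measurableSet_cylinder σ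

noncomputable def digitMap (x : ℝ) (n : ℕ) : Bool := decide ((⌊x * 2 ^ (n + 1)⌋ % 2 : ℤ) = 1)

theorem measurable_digitMap : Measurable digitMap := by
  rw [measurable_pi_iff]
  intro n
  have h1 : Measurable fun x : ℝ => ⌊x * 2 ^ (n + 1)⌋ := by fun_prop
  exact (measurable_of_countable (fun z : ℤ => decide (z % 2 = 1))).comp h1

def bigVal (X : Cantor) : ℕ → ℕ
  | 0 => 0
  | n + 1 => 2 * bigVal X n + (X n).toNat

theorem bigVal_lt (X : Cantor) (n : ℕ) : bigVal X n < 2 ^ n := by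
  induction n with
  | zero => simp [bigVal]
  | succ n ih => 
    have : (X n).toNat ≤ 1 := Bool.toNat_le _
    simp only [bigVal, pow_succ]; omega

theorem floor_succ (x : ℝ) (n : ℕ) :
    ⌊x * 2 ^ (n + 1)⌋ = 2 * ⌊x * 2 ^ n⌋ + ((digitMap x n).toNat : ℤ) := by
  have h1 : ⌊x * 2 ^ n⌋ = ⌊x * 2 ^ (n + 1)⌋ / 2 := by
    have := Int.floor_div_natCast (x * 2 ^ (n + 1)) 2
    rw [show ((2 : ℕ) : ℤ) = 2 from rfl] at this
    rw [← this]
    congr 1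
    push_cast
    rw [pow_succ]; ring
  rw [h1]
  unfold digitMap
  generalize ⌊x * 2 ^ (n + 1)⌋ = z
  by_cases h : z % 2 = 1
  · simp [h]; omega
  · simp [h]; omega

theorem digits_iff (Y : Cantor) {x : ℝ} (hx : x ∈ Set.Ico (0 : ℝ) 1) (n : ℕ) :
    (∀ i < n, digitMap x i = Y i) ↔ ⌊x * 2 ^ n⌋ = (bigVal Y n : ℤ) := by
  induction n with
  | zero => 
    simp only [bigVal, pow_zero, mul_one, Nat.cast_zero, Nat.not_lt_zero, false_imp_iff, implies_true, true_iff]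
    rw [Int.floor_eq_iff]; simpa using hx
  | succ n ih =>
    have e : (∀ i < n + 1, digitMap x i = Y i) ↔ (∀ i < n, digitMap x i = Y i) ∧ digitMap x n = Y n := by
      constructor
      · intro h; exact ⟨fun i hi => h i (by omega), h n (by omega)⟩
      · rintro ⟨h1, h2⟩ i hi
        rcases Nat.lt_succ_iff_lt_or_eq.mp hi with h | h
        · exact h1 i h
        · subst h; exact h2
    rw [e, ih, floor_succ, bigVal]
    push_cast
    generalize ⌊x * 2 ^ n⌋ = z
    rcases digitMap x n <;> rcases Y n <;> simp <;> omega

theorem fairCoin_cylinder (σ : List Bool) :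
    fairCoin (cylinder σ) = ((2 : ENNReal) ^ σ.length)⁻¹ := by
  change Measure.map digitMap _ _ = _
  rw [Measure.map_apply measurable_digitMap (measurableSet_cylinder σ),
    Measure.restrict_apply (measurable_digitMap (measurableSet_cylinder σ))]
  set Y : Cantor := fun i => σ.getD i false with hY
  set n := σ.length with hn
  have key : digitMap ⁻¹' cylinder σ ∩ Set.Ico 0 1 =
      Set.Ico ((bigVal Y n : ℝ) / 2 ^ n) (((bigVal Y n : ℝ) + 1) / 2 ^ n) := by
    have hp : (0 : ℝ) < 2 ^ n := by positivity
    have hc : ∀ x, x ∈ digitMap ⁻¹' cylinder σ ↔ ∀ i < n, digitMap x i = Y i := by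
      intro x
      constructor
      · intro h i hi
        have := h i hi
        simp only [hY]
        rw [this]; simp [hn ▸ hi]
      · intro h i hi
        have := h i hi
        rw [this]; simp [hY, hi]
    have hb : ((bigVal Y n : ℝ) + 1) ≤ 2 ^ n := by exact_mod_cast bigVal_lt Y n
    ext x
    have fl : ⌊x * 2 ^ n⌋ = (bigVal Y n : ℤ) ↔ x ∈ Set.Ico ((bigVal Y n : ℝ) / 2 ^ n) (((bigVal Y n : ℝ) + 1) / 2 ^ n) := by
      rw [Int.floor_eq_iff, Set.mem_Ico, div_le_iff₀ hp, lt_div_iff₀ hp]; simp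
    constructor
    · rintro ⟨h1, h2⟩
      exact fl.1 ((digits_iff Y h2 n).1 ((hc x).1 h1))
    · intro h
      have h2 : x ∈ Set.Ico (0 : ℝ) 1 := by
        refine ⟨le_trans (by positivity) h.1, lt_of_lt_of_le h.2 ?_⟩
        rw [div_le_one hp]; exact hb
      exact ⟨(hc x).2 ((digits_iff Y h2 n).2 (fl.2 h)), h2⟩
  rw [key, Real.volume_Ico]
  have : ((bigVal Y n : ℝ) + 1) / 2 ^ n - (bigVal Y n : ℝ) / 2 ^ n = (2 ^ n)⁻¹ := by ring
  rw [this, ENNReal.ofReal_inv_of_pos (by positivity), ENNReal.ofReal_pow (by norm_num)]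
  simp

instance : IsProbabilityMeasure fairCoin := by
  constructor
  have := fairCoin_cylinder []
  simpa [_root_.cylinder] using this

def cylinders : Set (Set Cantor) := insert ∅ (Set.range cylinder)

theorem isPiSystem_cylinders : IsPiSystem cylinders := by
  have key : ∀ σ τ : List Bool, σ.length ≤ τ.length → (cylinder σ ∩ cylinder τ).Nonempty →
      cylinder σ ∩ cylinder τ = cylinder τ := by
    rintro σ τ h ⟨X, h1, h2⟩
    apply Set.inter_eq_right.2
    intro Z hZ
    rw [mem_cylinder_iff] at *
    rw [← take_pre Z h, hZ, ← h2, take_pre X h, h1]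
  rintro _ (rfl | ⟨σ, rfl⟩) _ (rfl | ⟨τ, rfl⟩) hne
  · simp at hne
  · simp at hne
  · simp at hne
  · right
    rcases le_total σ.length τ.length with h | h
    · exact ⟨τ, (key σ τ h hne).symm⟩
    · rw [Set.inter_comm] at hne ⊢
      exact ⟨σ, (key τ σ h hne).symm⟩

theorem generateFrom_cylinders :
    (inferInstance : MeasurableSpace Cantor) = MeasurableSpace.generateFrom cylinders := by
  apply le_antisymm
  · have : ∀ i, Measurable[MeasurableSpace.generateFrom cylinders] (fun X : Cantor => X i) := by
      intro i
      let _ := MeasurableSpace.generateFrom cylinders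
      apply measurable_to_bool
      have : (fun X : Cantor => X i) ⁻¹' {true} =
          ⋃ σ ∈ {σ : List Bool | σ.length = i + 1 ∧ σ.getD i false = true}, cylinder σ := by
        ext X
        simp only [Set.mem_preimage, Set.mem_singleton_iff, Set.mem_iUnion, Set.mem_ofPred_eq, mem_cylinder_iff]
        constructor
        · intro h
          refine ⟨pre X (i+1), ⟨length_pre _ _, ?_⟩, ?_⟩
          · simp [pre, h]
          · rw [length_pre]
        · rintro ⟨σ, ⟨h1, h2⟩, h3⟩
          rw [← h3, h1] at h2
          simpa [pre] using h2
      rw [this]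
      exact MeasurableSet.biUnion (Set.to_countable _) fun σ _ =>
        MeasurableSpace.measurableSet_generateFrom (Or.inr ⟨σ, rfl⟩)
    exact iSup_le fun i => (this i).comap_le
  · apply MeasurableSpace.generateFrom_le
    rintro _ (rfl | ⟨σ, rfl⟩)
    · exact MeasurableSet.empty
    · exact measurableSet_cylinder σ

def xorMap (δ : Cantor) (X : Cantor) : Cantor := fun i => xor (X i) (δ i)

def xorStr (δ : Cantor) (σ : List Bool) : List Bool :=
  (List.range σ.length).map fun i => xor (σ.getD i false) (δ i)

theorem measurable_xorMap (δ) : Measurable (xorMap δ) := by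
  rw [measurable_pi_iff]
  intro i
  exact (measurable_of_countable (fun z : Bool => xor z (δ i))).comp (measurable_pi_apply i)

theorem xorMap_xorMap (δ X) : xorMap δ (xorMap δ X) = X := by
  funext i; simp [xorMap]

theorem preimage_cylinder (δ : Cantor) (σ : List Bool) :
    xorMap δ ⁻¹' cylinder σ = cylinder (xorStr δ σ) := by
  ext X
  have hl : (xorStr δ σ).length = σ.length := by simp [xorStr]
  have key : ∀ i (h : i < σ.length) (h' : i < (xorStr δ σ).length),
      xorMap δ X i = σ.get ⟨i, h⟩ ↔ X i = (xorStr δ σ).get ⟨i, h'⟩ := by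
    intro i h h'
    simp only [xorStr, xorMap, List.get_eq_getElem, List.getElem_map, List.getElem_range,
      List.getD_eq_getElem?_getD, List.getElem?_eq_getElem h, Option.getD_some]
    rcases X i <;> rcases σ[i] <;> rcases δ i <;> simp
  constructor
  · intro hX i h'
    exact (key i (hl ▸ h') h').1 (hX i (hl ▸ h'))
  · intro hX i h
    exact (key i h (hl.symm ▸ h)).2 (hX i (hl.symm ▸ h))

theorem map_xorMap (δ : Cantor) : fairCoin.map (xorMap δ) = fairCoin := by
  have := Measure.isProbabilityMeasure_map (μ := fairCoin) (measurable_xorMap δ).aemeasurable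
  refine ext_of_generate_finite cylinders generateFrom_cylinders isPiSystem_cylinders ?_ (by simp)
  rintro _ (rfl | ⟨σ, rfl⟩)
  · simp
  · rw [Measure.map_apply (measurable_xorMap δ) (measurableSet_cylinder σ), preimage_cylinder,
      fairCoin_cylinder, fairCoin_cylinder]
    simp [xorStr]

theorem primrec_xorStr (δ : List Bool) :
    Primrec (xorStr fun i => δ.getD i false) := by
  unfold xorStr
  refine Primrec.list_map (Primrec.list_range.comp Primrec.list_length) ?_
  exact (Primrec.dom_bool₂ xor).comp₂
    ((Primrec.list_getD false).comp₂ Primrec₂.left Primrec₂.right)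
    ((Primrec.list_getD false).comp₂ (Primrec₂.const δ) Primrec₂.right)

theorem testSet_xor (δ : Cantor) (U n) :
    testSet (fun n k => (U n k).map (xorStr δ)) n = xorMap δ ⁻¹' testSet U n := by
  ext X
  simp only [testSet, Set.preimage_iUnion, preimage_cylinder, Set.mem_iUnion, Set.mem_ofPred_eq,
    Option.map_eq_some_iff, exists_prop]
  constructor
  · rintro ⟨_, ⟨k, σ, h, rfl⟩, h2⟩; exact ⟨σ, ⟨k, h⟩, h2⟩
  · rintro ⟨σ, ⟨k, h⟩, h2⟩; exact ⟨_, ⟨k, σ, h, rfl⟩, h2⟩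

theorem mlr_of_eventually_eq {X Y : Cantor} (hX : X ∈ MLR) {N : ℕ} (h : ∀ n ≥ N, Y n = X n) :
    Y ∈ MLR := by
  intro U hU
  set δl : List Bool := (List.range N).map fun i => xor (X i) (Y i) with hδl
  set δ : Cantor := fun i => δl.getD i false with hδ
  have hXY : xorMap δ X = Y := by
    funext i
    by_cases hi : i < N
    · simp [xorMap, hδ, hδl, hi]
    · simp [xorMap, hδ, hδl, hi, h i (by omega)]
  have hT : MLTest (fun n k => (U n k).map (xorStr δ)) := by
    refine ⟨?_, fun n => ?_⟩
    · exact Computable.option_map (f := fun p : ℕ × ℕ => U p.1 p.2) hU.1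
        (((primrec_xorStr δl).to_comp.comp Computable.snd).to₂)
    · rw [testSet_xor, ← Measure.map_apply (measurable_xorMap δ) (measurableSet_testSet U n), map_xorMap]
      exact hU.2 n
  obtain ⟨n, hn⟩ := hX _ hT
  refine ⟨n, fun hc => hn ?_⟩
  rw [testSet_xor, Set.mem_preimage, hXY]
  exact hc

def nbits (n j : ℕ) : List Bool := (List.range n).map fun i => decide (j / 2 ^ i % 2 = 1)

theorem length_nbits (n j : ℕ) : (nbits n j).length = n := by simp [nbits]

theorem nbits_bitsToNat (l : List Bool) : nbits l.length (bitsToNat l) = l := by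
  induction l with
  | nil => simp [nbits]
  | cons b l ih =>
    rw [nbits, List.length_cons, List.range_succ_eq_map, List.map_cons, List.map_map]
    congr 1
    · rcases b <;> simp [bitsToNat]
    · conv_rhs => rw [← ih]
      unfold nbits
      apply List.map_congr_left
      intro i _
      have : bitsToNat (b :: l) / 2 ^ (i + 1) = bitsToNat l / 2 ^ i := by
        rw [pow_succ', ← Nat.div_div_eq_div_mul]
        congr 1
        rcases b <;> simp [bitsToNat]; omega
      simp [this]

theorem bitsToNat_lt (l : List Bool) : bitsToNat l < 2 ^ l.length := by
  induction l with
  | nil => simp [bitsToNat]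
  | cons b l ih =>
    rw [bitsToNat, List.length_cons, pow_succ]
    rcases b <;> simp <;> omega

theorem nbits_inj {n i j : ℕ} (hi : i < 2 ^ n) (hj : j < 2 ^ n) (h : nbits n i = nbits n j) :
    i = j := by
  apply Nat.eq_of_testBit_eq
  intro k
  by_cases hk : k < n
  · have := congrArg (fun l => l.getD k false) h
    simpa [nbits, hk, Nat.testBit_eq_decide_div_mod_eq] using this
  · have : 2 ^ n ≤ 2 ^ k := Nat.pow_le_pow_right (by norm_num) (by omega)
    rw [Nat.testBit_eq_false_of_lt (hi.trans_le this), Nat.testBit_eq_false_of_lt (hj.trans_le this)]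

theorem primrec_two_pow : Primrec fun n : ℕ => 2 ^ n := by
  have : Primrec fun n : ℕ => Nat.rec (motive := fun _ => ℕ) 1 (fun _ r => 2 * r) n :=
    Primrec.nat_rec₁ 1 (Primrec.nat_mul.comp₂ (Primrec₂.const 2) Primrec₂.right)
  refine this.of_eq fun n => ?_
  induction n with
  | zero => rfl
  | succ n ih => simp only [pow_succ']; rw [← ih]

theorem primrec_nbits : Primrec₂ nbits := by
  unfold nbits
  refine Primrec.list_map (Primrec.list_range.comp Primrec.fst) ?_
  refine PrimrecPred.decide ?_
  exact Primrec.eq.comp (Primrec.nat_mod.comp (Primrec.nat_div.comp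
    (Primrec.snd.comp Primrec.fst) (primrec_two_pow.comp Primrec.snd)) (Primrec.const 2))
    (Primrec.const 1)

/-- `α` extends some member of `L`. -/
def covered (L : List (List Bool)) (α : List Bool) : Prop := ∃ σ ∈ L, α.take σ.length = σ

instance (L α) : Decidable (covered L α) := by unfold covered; infer_instance

theorem primrec_covered : PrimrecRel covered := by
  unfold covered
  refine PrimrecRel.exists_mem_list (R := fun σ α : List Bool => α.take σ.length = σ) ?_
  exact Primrec.eq.comp
    (Primrec.list_take.comp (Primrec.list_length.comp Primrec.fst) Primrec.snd) Primrec.fst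

def cnt (L : List (List Bool)) : ℕ :=
  ((List.range (2 ^ L.flatten.length)).filter fun j => covered L (nbits L.flatten.length j)).length

theorem primrec_cnt : Primrec cnt := by
  have h : Primrec fun L : List (List Bool) => ((List.range (2 ^ L.flatten.length)).filterMap
      fun j => if covered L (nbits L.flatten.length j) then some j else none).length := by
    refine Primrec.list_length.comp (Primrec.listFilterMap
      (Primrec.list_range.comp (primrec_two_pow.comp (Primrec.list_length.comp Primrec.list_flatten))) ?_)
    refine Primrec.ite ?_ (Primrec.option_some.comp Primrec.snd) (Primrec.const none)
    exact primrec_covered.comp Primrec.fst (primrec_nbits.comp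
      (Primrec.list_length.comp (Primrec.list_flatten.comp Primrec.fst)) Primrec.snd)
  refine h.of_eq fun L => ?_
  rw [cnt, ← List.filterMap_eq_filter]
  congr 2
  funext j
  simp [Option.guard]

def good (m : ℕ) (L : List (List Bool)) : Prop := cnt L * 2 ^ m ≤ 2 ^ L.flatten.length

instance (m L) : Decidable (good m L) := by unfold good; infer_instance

theorem primrec_good : PrimrecRel good := by
  unfold good
  exact Primrec.nat_le.comp
    (Primrec.nat_mul.comp (primrec_cnt.comp Primrec.snd) (primrec_two_pow.comp Primrec.fst))
    (primrec_two_pow.comp (Primrec.list_length.comp (Primrec.list_flatten.comp Primrec.snd)))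

def listSet (L : List (List Bool)) : Set Cantor := ⋃ σ ∈ {σ | σ ∈ L}, _root_.cylinder σ

theorem mem_listSet {L : List (List Bool)} {X : Cantor} :
    X ∈ listSet L ↔ ∃ σ ∈ L, X ∈ _root_.cylinder σ := by simp [listSet]

theorem mem_listSet_iff {L : List (List Bool)} {X : Cantor} {s : ℕ} (hs : ∀ σ ∈ L, σ.length ≤ s) :
    X ∈ listSet L ↔ covered L (pre X s) := by
  rw [mem_listSet, covered]
  refine exists_congr fun σ => and_congr_right fun h => mem_cylinder_iff_take σ X (hs σ h)

theorem length_le_flatten {L : List (List Bool)} : ∀ σ ∈ L, σ.length ≤ L.flatten.length := by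
  intro σ h
  exact (List.sublist_flatten_of_mem h).length_le

theorem fairCoin_listSet (L : List (List Bool)) :
    fairCoin (listSet L) = cnt L * ((2 : ENNReal) ^ L.flatten.length)⁻¹ := by
  set N := L.flatten.length with hN
  set T : Finset ℕ := (Finset.range (2 ^ N)).filter fun j => covered L (nbits N j) with hT
  have hcard : T.card = cnt L := by
    rw [cnt, ← hN, hT]
    rw [← List.toFinset_card_of_nodup (List.nodup_range.filter _)]
    congr 1
    ext j; simp
  have hU : listSet L = ⋃ j ∈ T, _root_.cylinder (nbits N j) := by
    ext X
    rw [mem_listSet_iff (s := N) length_le_flatten]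
    simp only [Set.mem_iUnion, mem_cylinder_iff, length_nbits, exists_prop, hT, Finset.mem_filter,
      Finset.mem_range]
    constructor
    · intro h
      have e := nbits_bitsToNat (pre X N)
      have l := bitsToNat_lt (pre X N)
      rw [length_pre] at e l
      exact ⟨bitsToNat (pre X N), ⟨l, e.symm ▸ h⟩, e.symm⟩
    · rintro ⟨j, ⟨_, h⟩, e⟩
      rw [e]; exact h
  rw [hU, measure_biUnion_finset]
  · simp [fairCoin_cylinder, length_nbits, hcard]
  · intro i hi j hj hij
    apply Set.disjoint_left.2
    intro X h1 h2
    rw [mem_cylinder_iff, length_nbits] at h1 h2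
    simp only [hT, Finset.coe_filter, Finset.mem_range, Set.mem_ofPred_eq] at hi hj
    exact hij (nbits_inj hi.1 hj.1 (h1.symm.trans h2))
  · intro j _; exact measurableSet_cylinder _

theorem good_iff (m : ℕ) (L : List (List Bool)) :
    good m L ↔ fairCoin (listSet L) ≤ ((2 : ENNReal) ^ m)⁻¹ := by
  rw [fairCoin_listSet, good]
  generalize L.flatten.length = N
  rw [← div_eq_mul_inv, ENNReal.div_le_iff (by positivity) (by finiteness), mul_comm _⁻¹, ← div_eq_mul_inv,
    ENNReal.le_div_iff_mul_le (by left; positivity) (by left; finiteness)]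
  norm_cast

open Nat.Partrec (Code)

def stage (e m k : ℕ) : List (List Bool) :=
  (List.range k).filterMap fun j =>
    ((Code.evaln k (Denumerable.ofNat Code e) (Encodable.encode (m, j))).bind fun r =>
      (Encodable.decode (α := Option (List Bool)) r)).bind id

theorem primrec_stage : Primrec fun p : ℕ × ℕ × ℕ => stage p.1 p.2.1 p.2.2 := by
  unfold stage
  refine Primrec.listFilterMap (Primrec.list_range.comp (Primrec.snd.comp Primrec.snd)) ?_
  refine Primrec.option_bind ?_ (Primrec.snd.to₂)
  refine Primrec.option_bind ?_ ((Primrec.decode.comp Primrec.snd).to₂)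
  refine Code.primrec_evaln.comp (Primrec.pair (Primrec.pair ?_ ?_) ?_)
  · exact Primrec.snd.comp (Primrec.snd.comp Primrec.fst)
  · exact (Primrec.ofNat Code).comp (Primrec.fst.comp Primrec.fst)
  · exact Primrec.encode.comp (Primrec.pair (Primrec.fst.comp (Primrec.snd.comp Primrec.fst)) Primrec.snd)

theorem stage_mono {e m k k' : ℕ} (h : k ≤ k') {σ : List Bool} (hσ : σ ∈ stage e m k) :
    σ ∈ stage e m k' := by
  simp only [stage, List.mem_filterMap, List.mem_range, Option.bind_eq_some_iff] at hσ ⊢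
  obtain ⟨j, hj, o, ⟨r, hr, h2⟩, h3⟩ := hσ
  exact ⟨j, hj.trans_le h, o, ⟨r, Code.evaln_mono h hr, h2⟩, h3⟩

theorem listSet_mono {e m k k' : ℕ} (h : k ≤ k') : listSet (stage e m k) ⊆ listSet (stage e m k') := by
  intro X hX
  rw [mem_listSet] at hX ⊢
  obtain ⟨σ, h1, h2⟩ := hX
  exact ⟨σ, stage_mono h h1, h2⟩

def univAux (n e k j : ℕ) : Option (List Bool) :=
  if good (n + e + 1) (stage e (n + e + 1) k) then (stage e (n + e + 1) k)[j]? else none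

/-- The universal Martin-Löf test. -/
def univ (n i : ℕ) : Option (List Bool) :=
  univAux n i.unpair.1 i.unpair.2.unpair.1 i.unpair.2.unpair.2

theorem primrec_univ : Primrec₂ univ := by
  unfold univ univAux
  have hi : Primrec fun p : ℕ × ℕ => p.2.unpair := Primrec.unpair.comp Primrec.snd
  have he : Primrec fun p : ℕ × ℕ => p.2.unpair.1 := Primrec.fst.comp hi
  have hkj : Primrec fun p : ℕ × ℕ => p.2.unpair.2.unpair := Primrec.unpair.comp (Primrec.snd.comp hi)
  have hm : Primrec fun p : ℕ × ℕ => p.1 + p.2.unpair.1 + 1 :=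
    Primrec.succ.comp (Primrec.nat_add.comp Primrec.fst he)
  have hs : Primrec fun p : ℕ × ℕ => stage p.2.unpair.1 (p.1 + p.2.unpair.1 + 1) p.2.unpair.2.unpair.1 :=
    primrec_stage.comp (Primrec.pair he (Primrec.pair hm (Primrec.fst.comp hkj)))
  exact Primrec.ite (primrec_good.comp hm hs)
    (Primrec.list_getElem?.comp hs (Primrec.snd.comp hkj)) (Primrec.const none)

theorem mem_univ_iff (n : ℕ) (X : Cantor) : X ∈ testSet univ n ↔
    ∃ e k, good (n + e + 1) (stage e (n + e + 1) k) ∧ X ∈ listSet (stage e (n + e + 1) k) := by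
  simp only [testSet, Set.mem_iUnion, Set.mem_ofPred_eq, exists_prop]
  constructor
  · rintro ⟨σ, ⟨i, h⟩, hX⟩
    unfold univ univAux at h
    split_ifs at h with hg
    exact ⟨_, _, hg, mem_listSet.2 ⟨σ, List.mem_of_getElem? h, hX⟩⟩
  · rintro ⟨e, k, hg, hX⟩
    obtain ⟨σ, h1, h2⟩ := mem_listSet.1 hX
    obtain ⟨j, hj⟩ := List.mem_iff_getElem?.1 h1
    refine ⟨σ, ⟨Nat.pair e (Nat.pair k j), ?_⟩, h2⟩
    simp [univ, univAux, hg, hj]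

theorem mltest_univ : MLTest univ := by
  refine ⟨primrec_univ.to_comp, fun n => ?_⟩
  let G : ℕ → ℕ → Set Cantor := fun e k =>
    if good (n + e + 1) (stage e (n + e + 1) k) then listSet (stage e (n + e + 1) k) else ∅
  have h1 : testSet univ n = ⋃ e, ⋃ k, G e k := by
    ext X
    rw [mem_univ_iff]
    simp only [Set.mem_iUnion, G]
    refine exists_congr fun e => exists_congr fun k => ?_
    split_ifs with h <;> simp [h]
  have h2 : ∀ e k, fairCoin (G e k) ≤ ((2 : ENNReal) ^ (n + e + 1))⁻¹ := by
    intro e k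
    simp only [G]
    split_ifs with h
    · exact (good_iff _ _).1 h
    · simp
  have h3 : ∀ e, fairCoin (⋃ k, G e k) ≤ ((2 : ENNReal) ^ (n + e + 1))⁻¹ := by
    intro e
    rw [Directed.measure_iUnion]
    · exact iSup_le (h2 e)
    · have key : ∀ k k', k ≤ k' → ∃ z, G e k ⊆ G e z ∧ G e k' ⊆ G e z := by
        intro k k' hk
        by_cases hg : good (n + e + 1) (stage e (n + e + 1) k')
        · refine ⟨k', ?_, subset_rfl⟩
          simp only [G, if_pos hg]
          split_ifs with h
          · exact listSet_mono hk
          · simp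
        · refine ⟨k, subset_rfl, ?_⟩
          simp only [G, if_neg hg]
          simp
      intro k k'
      rcases le_total k k' with h | h
      · exact key k k' h
      · obtain ⟨z, h1, h2⟩ := key k' k h
        exact ⟨z, h2, h1⟩
  rw [h1]
  refine (measure_iUnion_le _).trans ((ENNReal.tsum_le_tsum h3).trans ?_)
  have : ∀ e : ℕ, ((2 : ENNReal) ^ (n + e + 1))⁻¹ = ((2 : ENNReal) ^ n)⁻¹ * 2⁻¹ ^ (e + 1) := by
    intro e
    rw [add_assoc, pow_add, ENNReal.mul_inv (by left; positivity) (by left; finiteness), ENNReal.inv_pow (n := e + 1)]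
  simp only [this]
  rw [ENNReal.tsum_mul_left, ENNReal.tsum_geometric_add_one]
  rw [ENNReal.one_sub_inv_two, inv_inv, ENNReal.inv_mul_cancel (by norm_num) (by norm_num), mul_one]

theorem univ_universal {X : Cantor} (hX : X ∉ MLR) (n : ℕ) : X ∈ testSet univ n := by
  have : ∃ U, MLTest U ∧ ∀ n, X ∈ testSet U n := by
    simpa [MLR] using hX
  obtain ⟨U, hU, hXU⟩ := this
  have hc : Computable fun p : ℕ × ℕ => U p.1 p.2 := hU.1
  obtain ⟨c, hc⟩ := Code.exists_code.1 hc
  have hev : ∀ m j, Code.eval c (Encodable.encode (m, j)) = Part.some (Encodable.encode (U m j)) := by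
    intro m j
    rw [hc]
    simp
  have hst : ∀ m k σ, σ ∈ stage (Encodable.encode c) m k → ∃ j, U m j = some σ := by
    intro m k σ hσ
    simp only [stage, List.mem_filterMap, List.mem_range, Option.bind_eq_some_iff,
      Denumerable.ofNat_encode] at hσ
    obtain ⟨j, hj, o, ⟨r, hr, h2⟩, h3⟩ := hσ
    have := Code.evaln_sound hr
    rw [hev, Part.mem_some_iff] at this
    rw [this, Encodable.encodek] at h2
    refine ⟨j, ?_⟩
    simp at h2 h3
    rw [h2, h3]
  have hgood : ∀ m k, good m (stage (Encodable.encode c) m k) := by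
    intro m k
    rw [good_iff]
    refine (measure_mono ?_).trans (hU.2 m)
    intro Z hZ
    obtain ⟨σ, h1, h2⟩ := mem_listSet.1 hZ
    exact Set.mem_biUnion (hst m k σ h1) h2
  rw [mem_univ_iff]
  set e := Encodable.encode c
  have hx := hXU (n + e + 1)
  simp only [testSet, Set.mem_iUnion, Set.mem_ofPred_eq, exists_prop] at hx
  obtain ⟨σ, ⟨j, hj⟩, hXσ⟩ := hx
  have hmem : Encodable.encode (U (n + e + 1) j) ∈ Code.eval c (Encodable.encode (n + e + 1, j)) := by
    rw [hev]; exact Part.mem_some _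
  obtain ⟨k, hk⟩ := Code.evaln_complete.1 hmem
  refine ⟨e, max k (j + 1), hgood _ _, mem_listSet.2 ⟨σ, ?_, hXσ⟩⟩
  simp only [stage, List.mem_filterMap, List.mem_range, Option.bind_eq_some_iff, e,
      Denumerable.ofNat_encode]
  refine ⟨j, by omega, some σ, ⟨_, Code.evaln_mono (le_max_left _ _) hk, ?_⟩, rfl⟩
  rw [Encodable.encodek, hj]

/-- The strings enumerated into level `n` of the universal test by stage `s`. -/
def univList (n s : ℕ) : List (List Bool) := (List.range s).filterMap fun k => univ n k

theorem primrec_univList : Primrec₂ univList := by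
  unfold univList
  exact Primrec.listFilterMap (Primrec.list_range.comp Primrec.snd)
    (primrec_univ.comp₂ ((Primrec.fst.comp Primrec.fst).to₂) Primrec₂.right)

/-- `α` is seen to be captured by level `n` by stage `|α|`. -/
def captured (n : ℕ) (α : List Bool) : Prop :=
  ∃ σ ∈ univList n α.length, σ.length ≤ α.length ∧ α.take σ.length = σ

theorem captured_iff (n : ℕ) (α : List Bool) : captured n α ↔ covered (univList n α.length) α := by
  unfold captured covered
  refine exists_congr fun σ => and_congr_right fun _ => ⟨fun h => h.2, fun h => ⟨?_, h⟩⟩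
  have := congrArg List.length h
  rw [List.length_take] at this
  omega

/-- Stagewise randomness deficiency. -/
def defi (α : List Bool) : ℕ :=
  (List.range α.length).findIdx fun n => !decide (covered (univList n α.length) α)

theorem primrec_defi : Primrec defi := by
  unfold defi
  refine Primrec.list_findIdx (Primrec.list_range.comp Primrec.list_length) ?_
  refine Primrec.not.comp (PrimrecPred.decide ?_)
  exact primrec_covered.comp (primrec_univList.comp Primrec.snd
    (Primrec.list_length.comp Primrec.fst)) Primrec.fst

theorem captured_mem {n s : ℕ} {X : Cantor} (h : captured n (pre X s)) : X ∈ testSet univ n := by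
  obtain ⟨σ, h1, h2, h3⟩ := h
  simp only [univList, List.mem_filterMap] at h1
  obtain ⟨k, _, hk⟩ := h1
  rw [length_pre] at h2
  exact Set.mem_biUnion (show σ ∈ {σ | ∃ k, univ n k = some σ} from ⟨k, hk⟩)
    ((mem_cylinder_iff_take σ X h2).2 h3)

theorem mem_captured {n : ℕ} {X : Cantor} (h : X ∈ testSet univ n) :
    ∀ᶠ s in Filter.atTop, captured n (pre X s) := by
  simp only [testSet, Set.mem_iUnion, Set.mem_ofPred_eq, exists_prop] at h
  obtain ⟨σ, ⟨k, hk⟩, hX⟩ := h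
  filter_upwards [Filter.eventually_ge_atTop (max (k + 1) σ.length)] with s hs
  refine ⟨σ, ?_, ?_, ?_⟩
  · simp only [univList, List.mem_filterMap, List.mem_range, length_pre]
    exact ⟨k, by omega, hk⟩
  · rw [length_pre]; omega
  · exact (mem_cylinder_iff_take σ X (by omega)).1 hX

theorem le_findIdx_range (p : ℕ → Bool) {M s : ℕ} (hM : M ≤ s) (h : ∀ n < M, p n = false) :
    M ≤ (List.range s).findIdx p := by
  by_contra hlt
  push Not at hlt
  have hl : (List.range s).findIdx p < (List.range s).length := by
    rw [List.length_range]; omega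
  have h1 := List.findIdx_getElem (w := hl)
  rw [List.getElem_range, h _ hlt] at h1
  exact Bool.noConfusion h1

theorem lt_defi {X : Cantor} {M : ℕ} (h : ∀ n < M, X ∈ testSet univ n) :
    ∀ᶠ s in Filter.atTop, M ≤ defi (pre X s) := by
  have h1 : ∀ᶠ s in Filter.atTop, ∀ n ∈ Finset.range M, captured n (pre X s) := by
    rw [Filter.eventually_all_finset]
    intro n hn
    exact mem_captured (h n (Finset.mem_range.1 hn))
  filter_upwards [h1, Filter.eventually_ge_atTop M] with s hs hM
  refine le_findIdx_range _ (by rw [length_pre]; exact hM) fun n hn => ?_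
  have hc := (captured_iff _ _).1 (hs n (Finset.mem_range.2 hn))
  rw [decide_eq_true hc]
  rfl

theorem defi_le {X : Cantor} {M : ℕ} (h : X ∉ testSet univ M) (s : ℕ) : defi (pre X s) ≤ M := by
  by_contra hlt
  push Not at hlt
  have hn := List.not_of_lt_findIdx (i := M) hlt
  simp only [List.getElem_range, Bool.not_eq_false', decide_eq_true_eq] at hn
  exact h (captured_mem ((captured_iff _ _).2 hn))

theorem defi_random {X : Cantor} (h : X ∈ MLR) :
    ∃ M, ∀ᶠ s in Filter.atTop, defi (pre X s) = M := by
  have hex := h univ mltest_univ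
  classical
  refine ⟨Nat.find hex, ?_⟩
  have h1 : ∀ n < Nat.find hex, X ∈ testSet univ n := fun n hn => by
    have := Nat.find_min hex hn
    simpa using this
  filter_upwards [lt_defi h1] with s hs
  exact le_antisymm (defi_le (Nat.find_spec hex) s) hs

theorem defi_nonrandom {X : Cantor} (h : X ∉ MLR) (M : ℕ) :
    ∀ᶠ s in Filter.atTop, M ≤ defi (pre X s) :=
  lt_defi fun n _ => univ_universal h n

/-- The value of output bit `n` as a function of the first `2n+2` bits of the oracle. -/
def outBit (n : ℕ) (l : List Bool) : Bool :=
  if defi ((List.range n).map fun i => l.getD (2 * i) false) ≤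
      defi ((List.range n).map fun i => l.getD (2 * i + 1) false)
  then l.getD (2 * n) false else l.getD (2 * n + 1) false

theorem primrec_outBit : Primrec₂ outBit := by
  unfold outBit
  have hd : Primrec fun n : ℕ => 2 * n := Primrec.nat_mul.comp (Primrec.const 2) Primrec.id
  have hd1 : Primrec fun n : ℕ => 2 * n + 1 := Primrec.succ.comp hd
  have hm : ∀ f : ℕ → ℕ, Primrec f → Primrec fun p : ℕ × List Bool =>
      (List.range p.1).map fun i => p.2.getD (f i) false := fun f hf =>
    Primrec.list_map (Primrec.list_range.comp Primrec.fst)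
      ((Primrec.list_getD false).comp (Primrec.snd.comp Primrec.fst) (hf.comp Primrec.snd))
  refine Primrec.ite (Primrec.nat_le.comp (primrec_defi.comp (hm _ hd)) (primrec_defi.comp (hm _ hd1))) ?_ ?_
  · exact (Primrec.list_getD false).comp Primrec.snd (hd.comp Primrec.fst)
  · exact (Primrec.list_getD false).comp Primrec.snd (hd1.comp Primrec.fst)

def qF (n : ℕ) : List ℕ := List.range (2 * n + 2)

def tF (n : ℕ) : List Bool :=
  (List.range (2 ^ (2 * n + 2))).map fun j => outBit n (nbits (2 * n + 2) j)

theorem tt_qt : TTReduction qF tF := by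
  refine ⟨Primrec.to_comp ?_, fun n => by simp [qF, tF]⟩
  have hd : Primrec fun n : ℕ => 2 * n + 2 :=
    Primrec.succ.comp (Primrec.succ.comp (Primrec.nat_mul.comp (Primrec.const 2) Primrec.id))
  refine Primrec.pair (Primrec.list_range.comp hd) ?_
  refine Primrec.list_map (Primrec.list_range.comp (primrec_two_pow.comp hd)) ?_
  exact primrec_outBit.comp Primrec.fst (primrec_nbits.comp (hd.comp Primrec.fst) Primrec.snd)

theorem ttEval_eq (A B : Cantor) (n : ℕ) : ttEval qF tF (join A B) n =
    if defi (pre A n) ≤ defi (pre B n) then A n else B n := by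
  set l := (qF n).map (join A B) with hl
  have hlen : l.length = 2 * n + 2 := by simp [hl, qF]
  have h1 : ttEval qF tF (join A B) n = outBit n l := by
    have e := nbits_bitsToNat l
    have hlt := bitsToNat_lt l
    rw [hlen] at e hlt
    simp only [ttEval, tF, ← hl]
    simp [hlt, e]
  have hget : ∀ i < 2 * n + 2, l.getD i false = join A B i := by
    intro i hi
    simp [hl, qF, hi]
  have hA : ∀ i ≤ n, l.getD (2 * i) false = A i := by
    intro i hi
    rw [hget _ (by omega)]
    simp [join]
  have hB : ∀ i ≤ n, l.getD (2 * i + 1) false = B i := by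
    intro i hi
    rw [hget _ (by omega)]
    simp [join, Nat.add_mod, show (2 * i + 1) / 2 = i by omega]
  have hAp : ((List.range n).map fun i => l.getD (2 * i) false) = pre A n :=
    List.map_congr_left fun i hi => hA i (List.mem_range.1 hi).le
  have hBp : ((List.range n).map fun i => l.getD (2 * i + 1) false) = pre B n :=
    List.map_congr_left fun i hi => hB i (List.mem_range.1 hi).le
  rw [h1, outBit, hAp, hBp, hA n le_rfl, hB n le_rfl]

/-- MLR is truth-table Medvedev reducible to Either(MLR). -/
theorem mlr_le_stt_either_mlr :
    ∃ (q : ℕ → List ℕ) (t : ℕ → List Bool), TTReduction q t ∧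
      ∀ X ∈ Either MLR, ttEval q t X ∈ MLR := by
  refine ⟨qF, tF, tt_qt, ?_⟩
  rintro _ ⟨A, B, rfl, hAB⟩
  have hA : A ∈ MLR → (∀ᶠ s in Filter.atTop, defi (pre A s) ≤ defi (pre B s)) →
      ttEval qF tF (join A B) ∈ MLR := by
    intro hA h
    obtain ⟨N, hN⟩ := Filter.eventually_atTop.1 h
    exact mlr_of_eventually_eq hA (N := N) fun n hn => by rw [ttEval_eq, if_pos (hN n hn)]
  have hB : B ∈ MLR → (∀ᶠ s in Filter.atTop, ¬ defi (pre A s) ≤ defi (pre B s)) →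
      ttEval qF tF (join A B) ∈ MLR := by
    intro hB h
    obtain ⟨N, hN⟩ := Filter.eventually_atTop.1 h
    exact mlr_of_eventually_eq hB (N := N) fun n hn => by rw [ttEval_eq, if_neg (hN n hn)]
  by_cases h1 : A ∈ MLR
  · obtain ⟨a, ha⟩ := defi_random h1
    by_cases h2 : B ∈ MLR
    · obtain ⟨b, hb⟩ := defi_random h2
      by_cases hab : a ≤ b
      · refine hA h1 ?_
        filter_upwards [ha, hb] with s h h'
        omega
      · refine hB h2 ?_
        filter_upwards [ha, hb] with s h h'
        omega
    · refine hA h1 ?_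
      filter_upwards [ha, defi_nonrandom h2 a] with s h h'
      omega
  · have h2 : B ∈ MLR := hAB.resolve_left h1
    obtain ⟨b, hb⟩ := defi_random h2
    refine hB h2 ?_
    filter_upwards [hb, defi_nonrandom h1 (b + 1)] with s h h'
    omega
end

section
/- MLR is not bounded-truth-table Medvedev reducible to Either(MLR): there is no bounded truth-table reduction Φ such that Φ^X ∈ MLR for every X ∈ Either(MLR). In symbols, MLR ≰_{s,btt} Either(MLR). -/
open MeasureTheory

/-- The binary digit map. -/
noncomputable def dig (x : ℝ) (n : ℕ) : Bool := decide ((⌊x * 2 ^ (n + 1)⌋ % 2 : ℤ) = 1)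

theorem measurable_dig : Measurable dig := by
  rw [measurable_pi_iff]
  intro n
  have h1 : Measurable (fun x : ℝ => ⌊x * 2 ^ (n + 1)⌋) :=
    Int.measurable_floor.comp (measurable_id.mul_const _)
  exact (measurable_from_top (f := fun z : ℤ => decide (z % 2 = 1))).comp h1

theorem fairCoin_apply {E : Set Cantor} (hE : MeasurableSet E) :
    fairCoin E = volume (dig ⁻¹' E ∩ Set.Ico 0 1) := by
  have : fairCoin = Measure.map dig (volume.restrict (Set.Ico (0 : ℝ) 1)) := rfl
  rw [this, Measure.map_apply measurable_dig hE,
    Measure.restrict_apply (measurable_dig hE)]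

theorem fairCoin_univ : fairCoin Set.univ = 1 := by
  rw [fairCoin_apply MeasurableSet.univ]; simp

theorem measurable_shift : Measurable (fun (X : Cantor) (n : ℕ) => X (n + 1)) :=
  measurable_pi_iff.2 fun n => measurable_pi_apply (n + 1)

theorem meas_bit (i : ℕ) (b : Bool) : MeasurableSet {X : Cantor | X i = b} :=
  measurableSet_eq_fun (measurable_pi_apply i) measurable_const

theorem meas_half (b : Bool) {E : Set Cantor} (hE : MeasurableSet E) :
    MeasurableSet {X : Cantor | X 0 = b ∧ (fun n => X (n + 1)) ∈ E} := by
  have : {X : Cantor | X 0 = b ∧ (fun n => X (n + 1)) ∈ E}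
      = {X : Cantor | X 0 = b} ∩ (fun (X : Cantor) (n : ℕ) => X (n + 1)) ⁻¹' E := by
    ext X; simp
  rw [this]
  exact (meas_bit 0 b).inter (measurable_shift hE)

theorem dig_shift (x : ℝ) (z : ℤ) (n : ℕ) : dig (2 * x + -(z : ℝ)) n = dig x (n + 1) := by
  have h : (2 * x + -(z : ℝ)) * 2 ^ (n + 1)
      = x * 2 ^ (n + 1 + 1) - ((2 * (z * 2 ^ n) : ℤ) : ℝ) := by push_cast; ring
  unfold dig
  rw [h, Int.floor_sub_intCast]
  congr 2
  omega

theorem fairCoin_half (b : Bool) {E : Set Cantor} (hE : MeasurableSet E) :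
    fairCoin {X | X 0 = b ∧ (fun n => X (n + 1)) ∈ E} = 2⁻¹ * fairCoin E := by
  have hm : MeasurableSet {X : Cantor | X 0 = b ∧ (fun n => X (n + 1)) ∈ E} :=
    meas_half b hE
  rw [fairCoin_apply hm, fairCoin_apply hE]
  set z : ℤ := cond b 1 0 with hz
  have hs : dig ⁻¹' {X | X 0 = b ∧ (fun n => X (n + 1)) ∈ E} ∩ Set.Ico 0 1
      = (fun x : ℝ => 2 * x) ⁻¹' ((fun y : ℝ => y + -(z : ℝ)) ⁻¹' (dig ⁻¹' E ∩ Set.Ico 0 1)) := by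
    ext x
    have e : dig (2 * x + -(z : ℝ)) = fun n => dig x (n + 1) := funext fun n => dig_shift x z n
    simp only [Set.mem_inter_iff, Set.mem_preimage, Set.mem_ofPred_eq, Set.mem_Ico, e]
    have key : (dig x 0 = b ∧ 0 ≤ x ∧ x < 1) ↔ (0 ≤ 2 * x + -(z : ℝ) ∧ 2 * x + -(z : ℝ) < 1) := by
      have h21 : (2 : ℝ) ^ (0 + 1) = 2 := by norm_num
      have hfl : ⌊x * 2 ^ (0 + 1)⌋ = z ↔ (0 ≤ 2 * x + -(z : ℝ) ∧ 2 * x + -(z : ℝ) < 1) := by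
        rw [Int.floor_eq_iff]
        constructor <;> rintro ⟨h1, h2⟩ <;> constructor <;> rw [h21] at * <;> linarith
      rw [← hfl]
      constructor
      · rintro ⟨h0, h1, h2⟩
        have f1 : 0 ≤ ⌊x * 2 ^ (0 + 1)⌋ := Int.floor_nonneg.2 (by rw [h21]; linarith)
        have f2 : ⌊x * 2 ^ (0 + 1)⌋ < 2 := Int.floor_lt.2 (by rw [h21]; push_cast; linarith)
        unfold dig at h0
        cases b
        · have := of_decide_eq_false h0
          simp only [cond_false] at hz
          omega
        · have := of_decide_eq_true h0
          simp only [cond_true] at hz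
          omega
      · intro h
        refine ⟨?_, ?_⟩
        · unfold dig
          rw [h]
          cases b <;> simp [hz]
        · have := Int.floor_eq_iff.1 h
          cases b <;> simp [hz] at this <;> constructor <;> linarith
    tauto
  rw [hs, Real.volume_preimage_mul_left (by norm_num), measure_preimage_add_right]
  congr 1
  rw [abs_of_pos (by norm_num), ENNReal.ofReal_inv_of_pos (by norm_num)]
  simp

theorem fairCoin_pattern (v : Bool) (N : ℕ) : ∀ s : Finset ℕ, (∀ i ∈ s, i < N) →
    fairCoin {X | ∀ i ∈ s, X i = v} = 2⁻¹ ^ s.card := by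
  induction N with
  | zero =>
    intro s hs
    have : s = ∅ := Finset.eq_empty_of_forall_notMem fun i hi => by simpa using hs i hi
    subst this
    simp [fairCoin_univ]
  | succ N ih =>
    intro s hs
    set s' : Finset ℕ := (Finset.range N).filter (fun i => i + 1 ∈ s) with hs'
    have mem' : ∀ i, i ∈ s' ↔ i + 1 ∈ s := by
      intro i
      simp only [hs', Finset.mem_filter, Finset.mem_range]
      exact ⟨fun h => h.2, fun h => ⟨by have := hs _ h; omega, h⟩⟩
    have ih' := ih s' (fun i hi => by simp [hs'] at hi; exact hi.1)
    have hE : MeasurableSet {X : Cantor | ∀ i ∈ s', X i = v} := by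
      have : {X : Cantor | ∀ i ∈ s', X i = v} = ⋂ i ∈ s', {X | X i = v} := by ext; simp
      rw [this]
      exact Finset.measurableSet_biInter _ fun i _ => meas_bit i v
    have hsplit : ∀ X : Cantor, (∀ i ∈ s, X i = v) ↔
        ((0 ∈ s → X 0 = v) ∧ ∀ i ∈ s', X (i + 1) = v) := by
      intro X
      constructor
      · intro h
        exact ⟨h 0, fun i hi => h _ ((mem' i).1 hi)⟩
      · rintro ⟨h0, h1⟩ i hi
        cases i with
        | zero => exact h0 hi
        | succ i => exact h1 i ((mem' i).2 hi)
    have himg : s.erase 0 = s'.image Nat.succ := by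
      ext i
      cases i with
      | zero => simp
      | succ i => simp [mem']
    have hcard : (s.erase 0).card = s'.card := by
      rw [himg, Finset.card_image_of_injective _ Nat.succ_injective]
    by_cases h0 : 0 ∈ s
    · have : {X : Cantor | ∀ i ∈ s, X i = v}
          = {X | X 0 = v ∧ (fun n => X (n + 1)) ∈ {X : Cantor | ∀ i ∈ s', X i = v}} := by
        ext X; simp only [Set.mem_ofPred_eq, hsplit X]; tauto
      rw [this, fairCoin_half v hE, ih', ← Finset.card_erase_add_one h0, hcard, pow_succ, mul_comm]
    · have : {X : Cantor | ∀ i ∈ s, X i = v}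
          = {X | X 0 = true ∧ (fun n => X (n + 1)) ∈ {X : Cantor | ∀ i ∈ s', X i = v}}
          ∪ {X | X 0 = false ∧ (fun n => X (n + 1)) ∈ {X : Cantor | ∀ i ∈ s', X i = v}} := by
        ext X
        simp only [Set.mem_ofPred_eq, Set.mem_union, hsplit X]
        cases X 0 <;> simp [h0]
      rw [this, measure_union, fairCoin_half _ hE, fairCoin_half _ hE, ih', ← add_mul,
        ENNReal.inv_two_add_inv_two, one_mul, ← hcard, Finset.erase_eq_of_notMem h0]
      · rw [Set.disjoint_left]
        rintro X ⟨h1, _⟩ ⟨h2, _⟩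
        simp [h1] at h2
      · exact meas_half _ hE

theorem countable_tests : {U : ℕ → ℕ → Option (List Bool) | Computable₂ U}.Countable := by
  let F : {U : ℕ → ℕ → Option (List Bool) | Computable₂ U} → {f : ℕ → ℕ // Computable f} :=
    fun U => ⟨fun n => Encodable.encode (U.1 n.unpair.1 n.unpair.2),
      Computable.encode.comp (U.2.comp (Computable.fst.comp Computable.unpair)
        (Computable.snd.comp Computable.unpair))⟩
  have hF : Function.Injective F := by
    intro U V h
    apply Subtype.ext
    funext a b
    have := congrFun (congrArg Subtype.val h) (Nat.pair a b)
    simpa [F] using this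
  exact hF.countable

theorem MLR_nonempty : ∃ R, R ∈ MLR := by
  by_contra hcon
  push Not at hcon
  have hc : {U : ℕ → ℕ → Option (List Bool) | MLTest U}.Countable :=
    countable_tests.mono fun U hU => hU.1
  have hnull : fairCoin (⋃ U ∈ {U : ℕ → ℕ → Option (List Bool) | MLTest U},
      ⋂ n, testSet U n) = 0 := by
    rw [measure_biUnion_null_iff hc]
    intro U hU
    refine le_antisymm ?_ bot_le
    refine ge_of_tendsto' (ENNReal.tendsto_pow_atTop_nhds_zero_of_lt_one
      (r := 2⁻¹) (by simp)) fun n => ?_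
    rw [← ENNReal.inv_pow]
    exact (measure_mono (Set.iInter_subset _ n)).trans (hU.2 n)
  have huniv : (⋃ U ∈ {U : ℕ → ℕ → Option (List Bool) | MLTest U},
      ⋂ n, testSet U n) = Set.univ := by
    ext X
    have := hcon X
    simp only [MLR, Set.mem_ofPred_eq] at this
    push Not at this
    simpa using this
  rw [huniv, fairCoin_univ] at hnull
  simp at hnull

theorem computable_and {α : Type} [Primcodable α] {f g : α → Bool} (hf : Computable f)
    (hg : Computable g) : Computable (fun a => f a && g a) :=
  Computable₂.comp (f := fun a b : Bool => a && b) Primrec.and.to_comp hf hg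

theorem computable_or {α : Type} [Primcodable α] {f g : α → Bool} (hf : Computable f)
    (hg : Computable g) : Computable (fun a => f a || g a) :=
  Computable₂.comp (f := fun a b : Bool => a || b) Primrec.or.to_comp hf hg

theorem computable_getD {α : Type} [Primcodable α] (d : Bool) {f : α → List Bool} {g : α → ℕ}
    (hf : Computable f) (hg : Computable g) : Computable (fun a => (f a).getD (g a) d) :=
  Computable₂.comp (f := fun (l : List Bool) n => l.getD n d) (Primrec.list_getD d).to_comp hf hg

/-- Boolean check that a string takes value `v` at positions `h 0, ..., h (k-1)`. -/
def checkStr (h : ℕ → ℕ) (v : Bool) (σ : List Bool) (k : ℕ) : Bool :=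
  Nat.rec true (fun i acc => acc && (σ.getD (h i) (!v) == v)) k

theorem checkStr_iff (h : ℕ → ℕ) (v : Bool) (σ : List Bool) (k : ℕ) :
    checkStr h v σ k = true ↔ ∀ i < k, σ.getD (h i) (!v) = v := by
  induction k with
  | zero => simp [checkStr]
  | succ k ih =>
    have : checkStr h v σ (k + 1) = (checkStr h v σ k && (σ.getD (h k) (!v) == v)) := rfl
    rw [this, Bool.and_eq_true, ih, beq_iff_eq]
    constructor
    · rintro ⟨h1, h2⟩ i hi
      rcases Nat.lt_succ_iff_lt_or_eq.1 hi with h3 | rfl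
      · exact h1 i h3
      · exact h2
    · intro h1
      exact ⟨fun i hi => h1 i (by omega), h1 k (by omega)⟩

theorem not_MLR_of_const (h : ℕ → ℕ) (hh : Computable h) (hm : StrictMono h) (v : Bool)
    (Y : Cantor) (hY : ∀ i, Y (h i) = v) : Y ∉ MLR := by
  intro hR
  let U : ℕ → ℕ → Option (List Bool) := fun k j =>
    (Encodable.decode (α := List Bool) j).bind fun σ =>
      cond (checkStr h v σ k) (some σ) none
  have hUc : Computable₂ U := by
    refine Computable.option_bind (Computable.decode.comp Computable.snd) ?_
    have hchk : Computable (fun p : (ℕ × ℕ) × List Bool => checkStr h v p.2 p.1.1) := by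
      refine Computable.nat_rec (f := fun p : (ℕ × ℕ) × List Bool => p.1.1)
        (h := fun p w => w.2 && (p.2.getD (h w.1) (!v) == v))
        (Computable.fst.comp Computable.fst) (Computable.const true) ?_
      refine computable_and (Computable.snd.comp Computable.snd) ?_
      refine Computable₂.comp (f := fun a b : Bool => a == b) Primrec.beq.to_comp ?_
        (Computable.const v)
      exact computable_getD (!v) (Computable.snd.comp Computable.fst)
        (hh.comp (Computable.fst.comp Computable.snd))
    exact Computable.cond hchk (Computable.option_some.comp Computable.snd) (Computable.const none)
  have hUmem : ∀ k σ, (∃ j, U k j = some σ) ↔ ∀ i < k, σ.getD (h i) (!v) = v := by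
    intro k σ
    rw [← checkStr_iff]
    constructor
    · rintro ⟨j, hj⟩
      simp only [U, Option.bind_eq_some_iff] at hj
      obtain ⟨σ', _, h2⟩ := hj
      cases hc : checkStr h v σ' k <;> simp [hc] at h2
      rw [← h2, hc]
    · intro hc
      exact ⟨Encodable.encode σ, by simp [U, hc]⟩
  have hT : MLTest U := by
    refine ⟨hUc, fun k => ?_⟩
    have hsub : testSet U k ⊆ {X | ∀ i ∈ (Finset.range k).image h, X i = v} := by
      intro X hX
      simp only [testSet, Set.mem_iUnion, Set.mem_ofPred_eq] at hX
      obtain ⟨σ, hσ, hXσ⟩ := hX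
      rw [hUmem] at hσ
      intro x hx
      obtain ⟨i, hi, rfl⟩ := Finset.mem_image.1 hx
      have h1 := hσ i (Finset.mem_range.1 hi)
      by_cases hl : h i < σ.length
      · rw [hXσ _ hl]
        rw [List.getD_eq_getElem _ _ hl] at h1
        simpa using h1
      · rw [List.getD_eq_default _ _ (by omega)] at h1
        cases v <;> simp at h1
    refine (measure_mono hsub).trans ?_
    rw [fairCoin_pattern v (h k) _ ?_, Finset.card_image_of_injective _ hm.injective,
      Finset.card_range, ENNReal.inv_pow]
    intro x hx
    obtain ⟨i, hi, rfl⟩ := Finset.mem_image.1 hx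
    exact hm (Finset.mem_range.1 hi)
  obtain ⟨k, hk⟩ := hR U hT
  apply hk
  simp only [testSet, Set.mem_iUnion, Set.mem_ofPred_eq]
  refine ⟨(List.range (h k)).map Y, ?_, ?_⟩
  · rw [hUmem]
    intro i hi
    have : h i < h k := hm hi
    rw [List.getD_eq_getElem _ _ (by simpa using this)]
    simp [hY]
  · intro i hi
    simp

theorem sunflower (q : ℕ → List ℕ) (c : ℕ) (hc : ∀ n, (q n).length ≤ c) :
    ∃ M, ∀ K, ∃ n, K ≤ n ∧ ∀ x ∈ q n, x < M ∨ K ≤ x := by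
  by_contra hcon
  push Not at hcon
  have key : ∀ j : ℕ, ∃ K, ∀ n, K ≤ n → j ≤ ((q n).toFinset.filter (· < K)).card := by
    intro j
    induction j with
    | zero => exact ⟨0, by simp⟩
    | succ j ih =>
      obtain ⟨M, hM⟩ := ih
      obtain ⟨K, hK⟩ := hcon M
      refine ⟨max M K, fun n hn => ?_⟩
      obtain ⟨x, hx, h1, h2⟩ := hK n (le_trans (le_max_right _ _) hn)
      refine (Nat.succ_le_succ (hM n (le_trans (le_max_left _ _) hn))).trans ?_
      refine Finset.card_lt_card ?_
      rw [Finset.ssubset_iff_of_subset]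
      · refine ⟨x, ?_, ?_⟩
        · simp [hx, h2]
        · simp; omega
      · intro y hy
        simp at hy ⊢
        exact ⟨hy.1, Or.inl hy.2⟩
  obtain ⟨K, hK⟩ := key (c + 1)
  have h1 := hK K le_rfl
  have h2 := Finset.card_filter_le (q K).toFinset (· < K)
  have h3 := List.toFinset_card_le (q K)
  have h4 := hc K
  omega

/-- One bound exceeding every list entry. -/
def ubd (l : List ℕ) : ℕ := l.foldr (fun a s => a + 1 + s) 0

theorem lt_ubd {l : List ℕ} {x : ℕ} (hx : x ∈ l) : x < ubd l := by
  induction l with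
  | nil => simp at hx
  | cons a l ih =>
    have : ubd (a :: l) = a + 1 + ubd l := rfl
    rcases List.mem_cons.1 hx with rfl | h
    · omega
    · have := ih h; omega

theorem primrec_ubd : Primrec ubd :=
  Primrec.list_foldr (h := fun _ p => p.1 + 1 + p.2) Primrec.id (Primrec.const 0)
    (Primrec.nat_add.comp (Primrec.succ.comp (Primrec.fst.comp Primrec.snd))
      (Primrec.snd.comp Primrec.snd))

/-- The separation predicate. -/
def sep (M K : ℕ) (l : List ℕ) : Bool := decide (∀ x ∈ l, x < M ∨ K ≤ x)

theorem primrec_sep (M : ℕ) : Primrec (fun p : ℕ × List ℕ => sep M p.1 p.2) := by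
  have h1 : PrimrecRel (fun (x K : ℕ) => x < M ∨ K ≤ x) :=
    PrimrecPred.or (Primrec.nat_lt.comp Primrec.fst (Primrec.const M))
      (Primrec.nat_le.comp Primrec.snd Primrec.fst)
  have h2 := h1.forall_mem_list
  exact (PrimrecRel.comp h2 Primrec.snd Primrec.fst).decide

/-- Computable thinning out to a sequence with separated queries. -/
theorem exists_seq (q : ℕ → List ℕ) (hq : Computable q) (T : ℕ → Bool) (hT : Computable T) (M : ℕ)
    (H : ∀ K, ∃ n, K ≤ n ∧ (∀ x ∈ q n, x < M ∨ K ≤ x) ∧ T n = true) :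
    ∃ h : ℕ → ℕ, Computable h ∧ StrictMono h ∧ (∀ i, T (h i) = true) ∧
      ∀ i j, i < j → ∀ x ∈ q (h i), x ∈ q (h j) → x < M := by
  let P : ℕ → ℕ → Bool := fun K n => decide (K ≤ n) && (sep M K (q n) && T n)
  have hPc : Computable₂ P := by
    refine computable_and (α := ℕ × ℕ) (f := fun p => decide (p.1 ≤ p.2))
      (g := fun p => sep M p.1 (q p.2) && T p.2) ?_
      (computable_and ?_ (hT.comp Computable.snd))
    · exact (Primrec.nat_le.decide).to_comp
    · exact (primrec_sep M).to_comp.comp (Computable.pair Computable.fst (hq.comp Computable.snd))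
  have hP : ∀ K n, P K n = true ↔ K ≤ n ∧ (∀ x ∈ q n, x < M ∨ K ≤ x) ∧ T n = true := by
    intro K n; simp [P, sep]
  have hex : ∀ K, ∃ n, P K n = true := fun K => by
    obtain ⟨n, hn⟩ := H K
    exact ⟨n, (hP K n).2 hn⟩
  let g : ℕ → ℕ := fun K => Nat.find (hex K)
  have hg : ∀ K, P K (g K) = true := fun K => Nat.find_spec (hex K)
  have hgc : Computable g := by
    refine Partrec.of_eq_tot (Partrec.rfind (p := fun K n => Part.some (P K n)) hPc) ?_
    intro K
    refine Nat.mem_rfind.2 ⟨by simp [hg K], fun {m} hm => ?_⟩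
    have := Nat.find_min (hex K) hm
    simpa using this
  let nx : ℕ → ℕ := fun n => g (n + 1 + ubd (q n))
  have hnx : Computable nx := by
    refine hgc.comp ?_
    exact Computable₂.comp Primrec.nat_add.to_comp Computable.succ (primrec_ubd.to_comp.comp hq)
  let h : ℕ → ℕ := fun i => Nat.rec (g 0) (fun _ r => nx r) i
  have hs : ∀ i, h (i + 1) = nx (h i) := fun i => rfl
  have hstep : ∀ i, h i + 1 + ubd (q (h i)) ≤ h (i + 1) ∧
      (∀ x ∈ q (h (i + 1)), x < M ∨ h i + 1 + ubd (q (h i)) ≤ x) := by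
    intro i
    have := (hP _ _).1 (hg (h i + 1 + ubd (q (h i))))
    exact ⟨this.1, this.2.1⟩
  have hmono : StrictMono h := strictMono_nat_of_lt_succ fun i => by
    have := (hstep i).1; omega
  refine ⟨h, ?_, hmono, ?_, ?_⟩
  · exact Computable.nat_rec (f := fun i : ℕ => i) (h := fun _ w => nx w.2) Computable.id
      (Computable.const _) (hnx.comp (Computable.snd.comp Computable.snd))
  · intro i
    cases i with
    | zero => exact ((hP _ _).1 (hg 0)).2.2
    | succ i => exact ((hP _ _).1 (hg (h i + 1 + ubd (q (h i))))).2.2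
  · intro i j hij x hi hj
    obtain ⟨j, rfl⟩ : ∃ j', j = j' + 1 := ⟨j - 1, by omega⟩
    rcases (hstep j).2 x hj with h1 | h1
    · exact h1
    · exfalso
      have h2 := lt_ubd hi
      rcases Nat.lt_succ_iff_lt_or_eq.1 hij with h3 | rfl
      · have h4 := (hstep i).1
        have h5 : h (i + 1) ≤ h j := hmono.monotone h3
        omega
      · omega

theorem primrec_bitsToNat : Primrec bitsToNat := by
  have h : Primrec (fun l : List Bool => l.foldr (fun b s => (cond b 1 0) + 2 * s) 0) :=
    Primrec.list_foldr (h := fun _ p => (cond p.1 1 0) + 2 * p.2) Primrec.id (Primrec.const 0)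
      (Primrec.nat_add.comp
        (Primrec.cond (Primrec.fst.comp Primrec.snd) (Primrec.const 1) (Primrec.const 0))
        (Primrec.nat_mul.comp (Primrec.const 2) (Primrec.snd.comp Primrec.snd)))
  refine h.of_eq fun l => ?_
  induction l with
  | nil => rfl
  | cons b l ih => simp only [List.foldr_cons, ih]; rfl

/-- The oracle given by fixed initial bits `r` and masks `a` (even part), `b` (odd part). -/
def comb (M : ℕ) (r a b : List Bool) (l : List ℕ) (x : ℕ) : Bool :=
  if x < M then r.getD x false else
    if x % 2 = 0 then a.getD (l.idxOf x) false else b.getD (l.idxOf x) false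

theorem primrec_comb (M : ℕ) (r a b : List Bool) :
    Primrec₂ (fun (l : List ℕ) (x : ℕ) => comb M r a b l x) := by
  have hi : Primrec (fun p : List ℕ × ℕ => p.1.idxOf p.2) :=
    Primrec.list_idxOf.comp Primrec.snd Primrec.fst
  refine Primrec.ite (Primrec.nat_lt.comp Primrec.snd (Primrec.const M))
    ((Primrec.list_getD false).comp (Primrec.const r) Primrec.snd) ?_
  refine Primrec.ite (Primrec.eq.comp (Primrec.nat_mod.comp Primrec.snd (Primrec.const 2))
    (Primrec.const 0)) ?_ ?_
  · exact (Primrec.list_getD false).comp (Primrec.const a) hi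
  · exact (Primrec.list_getD false).comp (Primrec.const b) hi

theorem computable_eval (q : ℕ → List ℕ) (t : ℕ → List Bool)
    (hqt : Computable (fun n => (q n, t n))) (M : ℕ) (r a b : List Bool) :
    Computable (fun n => ttEval q t (comb M r a b (q n)) n) := by
  have h : Primrec (fun p : List ℕ × List Bool =>
      p.2.getD (bitsToNat (p.1.map (comb M r a b p.1))) false) := by
    refine (Primrec.list_getD false).comp Primrec.snd (primrec_bitsToNat.comp ?_)
    exact Primrec.list_map Primrec.fst
      ((primrec_comb M r a b).comp (Primrec.fst.comp Primrec.fst) Primrec.snd)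
  exact h.to_comp.comp hqt

theorem computable_all {ι : Type} (L : List ι) (f : ι → ℕ → Bool) (hf : ∀ a, Computable (f a)) :
    Computable (fun n => L.all (fun a => f a n)) := by
  induction L with
  | nil => exact Computable.const true
  | cons a L ih => exact computable_and (hf a) ih

theorem computable_any {ι : Type} (L : List ι) (f : ι → ℕ → Bool) (hf : ∀ a, Computable (f a)) :
    Computable (fun n => L.any (fun a => f a n)) := by
  induction L with
  | nil => exact Computable.const false
  | cons a L ih => exact computable_or (hf a) ih

theorem ttEval_congr (q : ℕ → List ℕ) (t : ℕ → List Bool) (X Y : Cantor) (n : ℕ)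
    (h : ∀ x ∈ q n, X x = Y x) : ttEval q t X n = ttEval q t Y n := by
  unfold ttEval
  rw [List.map_congr_left h]

/-- Gluing masks along separated queries. -/
theorem exists_glue (q : ℕ → List ℕ) (h : ℕ → ℕ) (M : ℕ)
    (hd : ∀ i j, i < j → ∀ x ∈ q (h i), x ∈ q (h j) → x < M) (W : Cantor) (m : ℕ → List Bool) :
    ∃ Z : Cantor, ∀ i, ∀ x ∈ q (h i),
      Z x = if x < M then W x else (m i).getD ((q (h i)).idxOf x) false := by
  classical
  refine ⟨fun x => if x < M then W x else
    if hx : ∃ i, x ∈ q (h i) then (m hx.choose).getD ((q (h hx.choose)).idxOf x) false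
    else false, fun i x hx => ?_⟩
  by_cases hM : x < M
  · simp [hM]
  · have hex : ∃ i, x ∈ q (h i) := ⟨i, hx⟩
    have : hex.choose = i := by
      rcases lt_trichotomy hex.choose i with h1 | h1 | h1
      · exact absurd (hd _ _ h1 x hex.choose_spec hx) hM
      · exact h1
      · exact absurd (hd _ _ h1 x hx hex.choose_spec) hM
    simp only [hM, if_false, dif_pos hex, this]

theorem mask_getD (W : Cantor) (l : List ℕ) (x : ℕ) (hx : x ∈ l) :
    (l.map W).getD (l.idxOf x) false = W x := by
  have : l.idxOf x < l.length := List.idxOf_lt_length_of_mem hx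
  rw [List.getD_eq_getElem _ _ (by simpa using this)]
  simp

theorem initSeg_getD (W : Cantor) (M x : ℕ) (hx : x < M) :
    ((List.range M).map W).getD x false = W x := by
  rw [List.getD_eq_getElem _ _ (by simpa using hx)]
  simp

theorem join_even (A B : Cantor) (x : ℕ) (hx : x % 2 = 0) : join A B x = A (x / 2) := by
  simp [join, hx]

theorem join_odd (A B : Cantor) (x : ℕ) (hx : ¬ x % 2 = 0) : join A B x = B (x / 2) := by
  simp [join, hx]

/-- MLR is not bounded-truth-table Medvedev reducible to Either(MLR). -/
theorem mlr_not_le_sbtt_either_mlr :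
    ¬ ∃ (q : ℕ → List ℕ) (t : ℕ → List Bool), TTReduction q t ∧
      (∃ c : ℕ, ∀ n, (q n).length ≤ c) ∧
      ∀ X ∈ Either MLR, ttEval q t X ∈ MLR := by
  rintro ⟨q, t, ⟨hqt, -⟩, ⟨c, hc⟩, hΦ⟩
  have hq : Computable q := Computable.fst.comp hqt
  obtain ⟨R, hR⟩ := MLR_nonempty
  obtain ⟨M, hM⟩ := sunflower q c hc
  set W : Cantor := join R R with hW
  set r : List Bool := (List.range M).map W with hr
  set L : List (List Bool) := (List.finite_length_le Bool c).toFinset.toList with hL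
  have memL : ∀ l : List Bool, l.length ≤ c → l ∈ L := by
    intro l hl
    simp [hL, hl]
  have maskL : ∀ n, (q n).map W ∈ L := fun n => memL _ (by simpa using hc n)
  -- `T n` says that the even player can force the value `true` at `n`
  let T : ℕ → Bool := fun n => L.any fun a => L.all fun b => ttEval q t (comb M r a b (q n)) n
  have hT : Computable T := computable_any L _ fun a => computable_all L _ fun b =>
    computable_eval q t hqt M r a b
  have hpig : ∃ v : Bool, ∀ K, ∃ n, K ≤ n ∧ (∀ x ∈ q n, x < M ∨ K ≤ x) ∧ T n = v := by
    by_contra hcon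
    push Not at hcon
    obtain ⟨K1, h1⟩ := hcon true
    obtain ⟨K2, h2⟩ := hcon false
    obtain ⟨n, hn, hx⟩ := hM (max K1 K2)
    have g1 := h1 n (le_trans (le_max_left _ _) hn) fun x h => (hx x h).imp_right
      (le_trans (le_max_left _ _))
    have g2 := h2 n (le_trans (le_max_right _ _) hn) fun x h => (hx x h).imp_right
      (le_trans (le_max_right _ _))
    cases hTn : T n
    · exact g2 hTn
    · exact g1 hTn
  obtain ⟨v, hv⟩ := hpig
  cases v with
  | true =>
    obtain ⟨h, hhc, hmono, hTh, hd⟩ := exists_seq q hq T hT M hv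
    have hch : ∀ i, ∃ a, ∀ b ∈ L, ttEval q t (comb M r a b (q (h i))) (h i) = true := by
      intro i
      have := hTh i
      simp only [T, List.any_eq_true, List.all_eq_true] at this
      obtain ⟨a, _, ha⟩ := this
      exact ⟨a, ha⟩
    choose m hm using hch
    obtain ⟨Z, hZ⟩ := exists_glue q h M hd W m
    refine not_MLR_of_const h hhc hmono true (ttEval q t (join (fun k => Z (2 * k)) R)) ?_
      (hΦ _ ⟨_, _, rfl, Or.inr hR⟩)
    intro i
    rw [← hm i _ (maskL (h i))]
    refine ttEval_congr q t _ _ _ fun x hx => ?_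
    by_cases hx2 : x % 2 = 0
    · rw [join_even _ _ _ hx2, show 2 * (x / 2) = x by omega, hZ i x hx]
      by_cases hxM : x < M
      · simp only [comb, hxM, if_true]
        exact (initSeg_getD W M x hxM).symm
      · simp [comb, hxM, hx2]
    · rw [join_odd _ _ _ hx2]
      have hWx : W x = R (x / 2) := join_odd _ _ _ hx2
      rw [← hWx]
      by_cases hxM : x < M
      · simp only [comb, hxM, if_true]
        exact (initSeg_getD W M x hxM).symm
      · simp only [comb, hxM, hx2, if_false]
        exact (mask_getD W _ x hx).symm
  | false =>
    obtain ⟨h, hhc, hmono, hTh, hd⟩ := exists_seq q hq (fun n => !T n)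
      (Primrec.not.to_comp.comp hT) M (fun K => by simpa using hv K)
    have hch : ∀ i, ∃ b, ttEval q t
        (comb M r ((q (h i)).map W) b (q (h i))) (h i) = false := by
      intro i
      have h1 : T (h i) = false := by simpa using hTh i
      by_contra hcon
      push Not at hcon
      have h2 : T (h i) = true := by
        simp only [T, List.any_eq_true, List.all_eq_true]
        exact ⟨_, maskL (h i), fun b _ => by simpa using hcon b⟩
      simp [h1] at h2
    choose m hm using hch
    obtain ⟨Z, hZ⟩ := exists_glue q h M hd W m
    refine not_MLR_of_const h hhc hmono false (ttEval q t (join R (fun k => Z (2 * k + 1)))) ?_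
      (hΦ _ ⟨_, _, rfl, Or.inl hR⟩)
    intro i
    rw [← hm i]
    refine ttEval_congr q t _ _ _ fun x hx => ?_
    by_cases hx2 : x % 2 = 0
    · rw [join_even _ _ _ hx2]
      have hWx : W x = R (x / 2) := join_even _ _ _ hx2
      rw [← hWx]
      by_cases hxM : x < M
      · simp only [comb, hxM, if_true]
        exact (initSeg_getD W M x hxM).symm
      · simp only [comb, hxM, hx2, if_true, if_false]
        exact (mask_getD W _ x hx).symm
    · rw [join_odd _ _ _ hx2, show 2 * (x / 2) + 1 = x by omega, hZ i x hx]
      by_cases hxM : x < M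
      · simp only [comb, hxM, if_true]
        exact (initSeg_getD W M x hxM).symm
      · simp [comb, hxM, hx2]
end
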